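/- For all integers n ≥ 3 and 1 ≤ m ≤ ⌊(n−1)/2⌋, under the explicit labeling g of the generalised Petersen graph P(n,m) (defined in the context), the edge-weights of the n inner edges v_iv_{i+m} are pairwise distinct; indeed wt_g(v_iv_{i+m}) = g(v_i)+g(v_{i+m})+g(v_iv_{i+m}) = 7n+1+r(i+m), where r(j) ∈ {1,...,n} denotes the representative of j modulo n, so these weights form the set {7n+2, 7n+3, ..., 8n+1}. -/

import Mathlib

open Sum

/-- The weight of an edge `e` under a total labeling `f` of the graph `G`:
the label of `e` plus the labels of its two endpoints. -/
noncomputable def edgeWt {V : Type*} (G : SimpleGraph V) (f : V ⊕ G.edgeSet → ℕ)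
    (e : G.edgeSet) : ℕ :=
  f (inr e) + ∑ᶠ (v : V) (_ : v ∈ (e : Sym2 V)), f (inl v)

/-- The weight of a vertex `v` under a total labeling `f` of the graph `G`:
the label of `v` plus the labels of all edges incident with `v`. -/
noncomputable def vertexWt {V : Type*} (G : SimpleGraph V) (f : V ⊕ G.edgeSet → ℕ)
    (v : V) : ℕ :=
  f (inl v) + ∑ᶠ (e : G.edgeSet) (_ : v ∈ (e : Sym2 V)), f (inr e)

/-- The generalised Petersen graph `P(n,m)`, with outer vertices `u_i = inl i` and
inner vertices `v_i = inr i` (`i` running over `Fin n`), outer cycle edges `u_i u_{i+1}`,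
spokes `u_i v_i`, and inner edges `v_i v_{i+m}` (indices mod `n`). -/
def petersen (n m : ℕ) : SimpleGraph (Fin n ⊕ Fin n) :=
  SimpleGraph.fromRel (fun a b =>
    (∃ p q : Fin n, ((p : ℕ) + 1) % n = (q : ℕ) ∧ a = inl p ∧ b = inl q) ∨
    (∃ p q : Fin n, ((p : ℕ) + m) % n = (q : ℕ) ∧ a = inr p ∧ b = inr q) ∨
    (∃ p : Fin n, a = inl p ∧ b = inr p))

/-- Helper for labeling the edges of a cycle-like structure symmetrically: on an edge
joining `p` to `q = (p + s) mod n` it takes the value `base - p` (0-based indices). -/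
def cycEL (n s base : ℕ) (p q : Fin n) : ℕ :=
  if (q : ℕ) = ((p : ℕ) + s) % n ∧ (p : ℕ) = ((q : ℕ) + s) % n then
    base - min (p : ℕ) (q : ℕ)
  else if (q : ℕ) = ((p : ℕ) + s) % n then base - (p : ℕ)
  else if (p : ℕ) = ((q : ℕ) + s) % n then base - (q : ℕ)
  else 0

lemma cycEL_comm (n s base : ℕ) (p q : Fin n) : cycEL n s base p q = cycEL n s base q p := by
  unfold cycEL
  by_cases h1 : (q : ℕ) = ((p : ℕ) + s) % n <;> by_cases h2 : (p : ℕ) = ((q : ℕ) + s) % n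
  · rw [if_pos ⟨h1, h2⟩, if_pos ⟨h2, h1⟩, Nat.min_comm]
  · rw [if_neg (fun h => h2 h.2), if_pos h1, if_neg (fun h => h2 h.1), if_neg h2, if_pos h1]
  · rw [if_neg (fun h => h1 h.1), if_neg h1, if_pos h2, if_neg (fun h => h1 h.2), if_pos h2]
  · rw [if_neg (fun h => h1 h.1), if_neg h1, if_neg h2, if_neg (fun h => h2 h.1), if_neg h2,
      if_neg h1]

/-- Labels of the vertices of `P(n,m)`: `g(u_i) = i` and `g(v_i) = n + i`
(1-based index `i = k + 1`). -/
def petVL (n : ℕ) : Fin n ⊕ Fin n → ℕ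
  | inl k => (k : ℕ) + 1
  | inr k => n + (k : ℕ) + 1

/-- Labels of the edges of `P(n,m)`, written as a symmetric function of the two
endpoints: `g(u_i u_{i+1}) = 3n - i + 1`, `g(u_1 v_1) = 3n + 1`,
`g(u_i v_i) = 4n - i + 2` for `2 ≤ i ≤ n`, and `g(v_i v_{i+m}) = 5n - i + 1`
(all indices 1-based, `i = k + 1`). -/
def petEL (n m : ℕ) : Fin n ⊕ Fin n → Fin n ⊕ Fin n → ℕ
  | inl p, inl q => cycEL n 1 (3 * n) p q
  | inr p, inr q => cycEL n m (5 * n) p q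
  | inl p, inr _ => if (p : ℕ) = 0 then 3 * n + 1 else 4 * n - (p : ℕ) + 1
  | inr _, inl q => if (q : ℕ) = 0 then 3 * n + 1 else 4 * n - (q : ℕ) + 1

lemma petEL_comm (n m : ℕ) (a b : Fin n ⊕ Fin n) : petEL n m a b = petEL n m b a := by
  rcases a with p | p <;> rcases b with q | q <;> simp [petEL, cycEL_comm]

/-- The explicit super total labeling `g` of the generalised Petersen graph `P(n,m)`
from the paper. -/
def petLabel (n m : ℕ) : (Fin n ⊕ Fin n) ⊕ (petersen n m).edgeSet → ℕ :=
  Sum.elim (petVL n)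
    (fun e => Sym2.lift ⟨petEL n m, petEL_comm n m⟩ (e : Sym2 (Fin n ⊕ Fin n)))

/-- The inner edge `v_p v_{p+m}` of `P(n,m)` (0-based indices, taken mod `n`). -/
def innerEdge (n m : ℕ) (p : Fin n) : Sym2 (Fin n ⊕ Fin n) :=
  s(inr p, inr ⟨((p : ℕ) + m) % n, Nat.mod_lt _ p.pos⟩)

lemma edgeWt_eq_of_coe_eq_mk {V : Type*} (G : SimpleGraph V) (f : V ⊕ G.edgeSet → ℕ)
    (e : G.edgeSet) {a b : V} (hab : a ≠ b) (he : (e : Sym2 V) = s(a, b)) :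
    edgeWt G f e = f (inr e) + (f (inl a) + f (inl b)) := by
  rw [edgeWt, he, ← finsum_mem_pair (f := fun v => f (inl v)) hab]
  simp only [Sym2.mem_iff, Set.mem_insert_iff, Set.mem_singleton_iff]

lemma Nat.add_mod_ne_self {n p k : ℕ} (hp : p < n) (hk : 0 < k) (hkn : k < n) :
    (p + k) % n ≠ p := by
  rcases lt_or_ge (p + k) n with h | h
  · rw [Nat.mod_eq_of_lt h]
    omega
  · rw [Nat.mod_eq_sub_mod h, Nat.mod_eq_of_lt (by omega)]
    omega

lemma cycEL_of_eq_add_mod {n s : ℕ} (base : ℕ) {p q : Fin n} (hs : 0 < s) (hsn : 2 * s < n)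
    (hq : (q : ℕ) = ((p : ℕ) + s) % n) : cycEL n s base p q = base - p := by
  have hp : ¬(p : ℕ) = ((q : ℕ) + s) % n := by
    rw [hq, Nat.mod_add_mod, add_assoc, ← two_mul]
    exact (Nat.add_mod_ne_self p.isLt (by omega) hsn).symm
  rw [cycEL, if_neg (fun h => hp h.2), if_pos hq]

lemma innerEdge_mem_edgeSet {n m : ℕ} (hm : 0 < m) (hmn : m < n) (p : Fin n) :
    innerEdge n m p ∈ (petersen n m).edgeSet := by
  rw [innerEdge, SimpleGraph.mem_edgeSet, petersen, SimpleGraph.fromRel_adj]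
  refine ⟨fun h => ?_, Or.inl (Or.inr (Or.inl ⟨p, _, rfl, rfl, rfl⟩))⟩
  exact Nat.add_mod_ne_self p.isLt hm hmn (congrArg Fin.val (inr_injective h)).symm

lemma edgeWt_petLabel_of_eq_innerEdge {n m : ℕ} (hm : 0 < m) (hmn : 2 * m < n) (p : Fin n)
    (e : (petersen n m).edgeSet) (he : (e : Sym2 (Fin n ⊕ Fin n)) = innerEdge n m p) :
    edgeWt (petersen n m) (petLabel n m) e = 7 * n + 1 + (((p : ℕ) + m) % n + 1) := by
  have hne : (inr p : Fin n ⊕ Fin n) ≠ inr ⟨((p : ℕ) + m) % n, Nat.mod_lt _ p.pos⟩ := fun h =>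
    Nat.add_mod_ne_self p.isLt hm (by omega) (congrArg Fin.val (inr_injective h)).symm
  rw [edgeWt_eq_of_coe_eq_mk _ _ e hne he]
  simp only [petLabel, elim_inl, elim_inr, he, innerEdge, Sym2.lift_mk, petEL, petVL]
  rw [cycEL_of_eq_add_mod _ hm hmn rfl]
  have := p.isLt
  omega

/-- For all `n ≥ 3` and `1 ≤ m ≤ ⌊(n-1)/2⌋`, under the explicit labeling `g` of the
generalised Petersen graph `P(n,m)`: the edge-weight of the inner edge `v_i v_{i+m}`
equals `7n + 1 + r(i+m)`, where `r(j) ∈ {1, …, n}` is the representative of `j` mod `n`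
(for the 1-based index `i = p + 1`, `r(i+m) = ((p + m) mod n) + 1`); these weights are
pairwise distinct; and they form exactly the set `{7n+2, …, 8n+1}`. -/
theorem petLabel_inner_edge_weights (n m : ℕ) (hn : 3 ≤ n) (hm1 : 1 ≤ m)
    (hm2 : m ≤ (n - 1) / 2) :
    (∀ (p : Fin n) (e : (petersen n m).edgeSet),
      (e : Sym2 (Fin n ⊕ Fin n)) = innerEdge n m p →
      edgeWt (petersen n m) (petLabel n m) e = 7 * n + 1 + (((p : ℕ) + m) % n + 1)) ∧
    (∀ (p q : Fin n) (e e' : (petersen n m).edgeSet),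
      (e : Sym2 (Fin n ⊕ Fin n)) = innerEdge n m p →
      (e' : Sym2 (Fin n ⊕ Fin n)) = innerEdge n m q → p ≠ q →
      edgeWt (petersen n m) (petLabel n m) e ≠ edgeWt (petersen n m) (petLabel n m) e') ∧
    {w : ℕ | ∃ e : (petersen n m).edgeSet,
        (∃ p : Fin n, (e : Sym2 (Fin n ⊕ Fin n)) = innerEdge n m p) ∧
        edgeWt (petersen n m) (petLabel n m) e = w} =
      Set.Icc (7 * n + 2) (8 * n + 1) := by
  have hmn : 2 * m < n := by omega
  have wt := edgeWt_petLabel_of_eq_innerEdge (n := n) hm1 hmn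
  refine ⟨wt, fun p q e e' he he' hpq h => hpq ?_, Set.ext fun w => ⟨?_, fun hw => ?_⟩⟩
  · rw [wt p e he, wt q e' he'] at h
    have hmod : (p : ℕ) + m ≡ q + m [MOD n] := by
      change ((p : ℕ) + m) % n = (q + m) % n
      omega
    exact Fin.ext (hmod.add_right_cancel'.eq_of_lt_of_lt p.isLt q.isLt)
  · rintro ⟨e, ⟨p, he⟩, rfl⟩
    have := Nat.mod_lt ((p : ℕ) + m) p.pos
    rw [wt p e he, Set.mem_Icc]
    omega
  · rw [Set.mem_Icc] at hw
    let p : Fin n := ⟨(w - (7 * n + 2) + (n - m)) % n, Nat.mod_lt _ (by omega)⟩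
    refine ⟨⟨_, innerEdge_mem_edgeSet hm1 (by omega) p⟩, ⟨p, rfl⟩, ?_⟩
    have hp : ((p : ℕ) + m) % n = w - (7 * n + 2) := by
      rw [Nat.mod_add_mod, add_assoc, Nat.sub_add_cancel (by omega), Nat.add_mod_right,
        Nat.mod_eq_of_lt (by omega)]
    rw [wt p _ rfl, hp]
    omega
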